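/- arXiv:2309.01185 — 4 statements merged into one kernel-verified Lean document; each statement's English description precedes it below -/
import Mathlib

section
/- Let 0 ≤ R̲ ≤ R̄ and let θ̲ ≤ θ̄ be real numbers with θ̄ − θ̲ < π. Then every point s ∈ ℝ² of the form s = r·u(θ) with 0 ≤ r ≤ R̄ and θ̲ ≤ θ ≤ θ̄ can be written as s = ξ₁·u(θ̄) + ξ₂·u(θ̲) with coefficients satisfying 0 ≤ ξ₁ ≤ R̄ / cos((θ̄ − θ̲)/2) and 0 ≤ ξ₂ ≤ R̄ / cos((θ̄ − θ̲)/2). (Cone/triangle containment step in the proof of Lemma 2: the circular sector is covered by nonnegative combinations of the two boundary direction vectors with the stated bounds.) -/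
/-- The unit vector `u(θ) = (cos θ, sin θ) ∈ ℝ²`. -/
noncomputable def u (θ : ℝ) : EuclideanSpace ℝ (Fin 2) :=
  (WithLp.equiv 2 (Fin 2 → ℝ)).symm ![Real.cos θ, Real.sin θ]

/-- The interpolation coefficient `sin a / sin D` lies between `0` and `1 / cos (D / 2)`. -/
theorem mul_sin_div_sin_mem_Icc {r R a D : ℝ} (hr0 : 0 ≤ r) (hrR : r ≤ R) (ha : 0 ≤ a)
    (haD : a ≤ D) (hD0 : 0 < D) (hD : D < Real.pi) :
    r * Real.sin a / Real.sin D ∈ Set.Icc 0 (R / Real.cos (D / 2)) := by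
  have hsD : 0 < Real.sin D := Real.sin_pos_of_pos_of_lt_pi hD0 hD
  have hsa : 0 ≤ Real.sin a := Real.sin_nonneg_of_nonneg_of_le_pi ha (by linarith)
  have hc : 0 < Real.cos (D / 2) := Real.cos_pos_of_mem_Ioo ⟨by linarith, by linarith⟩
  refine ⟨by positivity, ?_⟩
  have hsin2 : Real.sin D = 2 * Real.sin (D / 2) * Real.cos (D / 2) := by
    rw [← Real.sin_two_mul]; ring_nf
  have ha2 : Real.sin a = 2 * Real.sin (a / 2) * Real.cos (a / 2) := by
    rw [← Real.sin_two_mul]; ring_nf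
  have hs0 : 0 ≤ Real.sin (a / 2) :=
    Real.sin_nonneg_of_nonneg_of_le_pi (by linarith) (by linarith)
  have hmono : Real.sin (a / 2) ≤ Real.sin (D / 2) :=
    Real.sin_le_sin_of_le_of_le_pi_div_two (by linarith) (by linarith) (by linarith)
  have hle : Real.sin a ≤ 2 * Real.sin (D / 2) := by
    rw [ha2]
    nlinarith [mul_le_mul_of_nonneg_left (Real.cos_le_one (a / 2)) hs0]
  rw [div_le_div_iff₀ hsD hc]
  calc r * Real.sin a * Real.cos (D / 2)
      ≤ R * (2 * Real.sin (D / 2)) * Real.cos (D / 2) := by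
        have := hr0.trans hrR
        gcongr
    _ = R * Real.sin D := by rw [hsin2]; ring

/-- Any unit vector is a combination of two others, with sines of differences as weights. -/
theorem sin_sub_smul_u (a b t : ℝ) :
    Real.sin (b - a) • u t = Real.sin (t - a) • u b + Real.sin (b - t) • u a := by
  ext i
  fin_cases i <;> simp [u, Real.sin_sub] <;> ring

/-- Cone/triangle containment step in the proof of Lemma 2: every point of the circular
sector `{r·u(θ) : 0 ≤ r ≤ R̄, θ̲ ≤ θ ≤ θ̄}` is a nonnegative combination of the two
boundary direction vectors with coefficients bounded by `R̄ / cos((θ̄ − θ̲)/2)`. -/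
theorem stmt5 (Rlo Rhi θlo θhi : ℝ) (h0 : 0 ≤ Rlo) (hR : Rlo ≤ Rhi) (hθ : θlo ≤ θhi)
    (hπ : θhi - θlo < Real.pi) (r θ : ℝ) (hr0 : 0 ≤ r) (hrR : r ≤ Rhi)
    (hθ1 : θlo ≤ θ) (hθ2 : θ ≤ θhi) :
    ∃ ξ₁ ξ₂ : ℝ, r • u θ = ξ₁ • u θhi + ξ₂ • u θlo ∧
      0 ≤ ξ₁ ∧ ξ₁ ≤ Rhi / Real.cos ((θhi - θlo) / 2) ∧
      0 ≤ ξ₂ ∧ ξ₂ ≤ Rhi / Real.cos ((θhi - θlo) / 2) := by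
  have hR0 : 0 ≤ Rhi := h0.trans hR
  rcases hθ.eq_or_lt with rfl | hlt
  · obtain rfl : θ = θlo := le_antisymm hθ2 hθ1
    exact ⟨r, 0, by simp, hr0, by simpa using hrR, le_rfl, by simpa using hR0⟩
  · have hs : Real.sin (θhi - θlo) ≠ 0 :=
      (Real.sin_pos_of_pos_of_lt_pi (sub_pos.2 hlt) hπ).ne'
    obtain ⟨h1, h2⟩ := mul_sin_div_sin_mem_Icc hr0 hrR (sub_nonneg.2 hθ1)
      (sub_le_sub_right hθ2 θlo) (sub_pos.2 hlt) hπ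
    obtain ⟨h3, h4⟩ := mul_sin_div_sin_mem_Icc hr0 hrR (sub_nonneg.2 hθ2)
      (sub_le_sub_left hθ1 θhi) (sub_pos.2 hlt) hπ
    refine ⟨_, _, ?_, h1, h2, h3, h4⟩
    calc r • u θ = (r / Real.sin (θhi - θlo)) • (Real.sin (θhi - θlo) • u θ) := by
          rw [smul_smul, div_mul_cancel₀ _ hs]
      _ = _ := by
          rw [sin_sub_smul_u, smul_add, smul_smul, smul_smul, div_mul_eq_mul_div,
            div_mul_eq_mul_div]
end

section
/- Let 0 ≤ R̲ ≤ R̄, let θ̲ ≤ θ̄ with θ̄ − θ̲ < π, set θ_m = (θ̄ + θ̲)/2, σ₁ = R̲·cos((θ̄ − θ̲)/2), σ₂ = R̄, and let c ∈ ℝ² be any point. Then the translated sector {c + r·u(θ) : R̲ ≤ r ≤ R̄, θ̲ ≤ θ ≤ θ̄} is contained in the set { c + ξ₁·u(θ̄) + ξ₂·u(θ̲) : 0 ≤ ξ₁ ≤ R̄/cos((θ̄−θ̲)/2), 0 ≤ ξ₂ ≤ R̄/cos((θ̄−θ̲)/2), and σ₁ ≤ ⟨u(θ_m), ξ₁·u(θ̄)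 + ξ₂·u(θ̲)⟩ ≤ σ₂ }. (Lemma 2 of the paper: the set consistent with combined relative range and bearing measurements is outer bounded by an extended constrained zonotope given by cone coefficients together with a hyperplane-band constraint.) -/
open scoped RealInnerProductSpace

theorem inner_u_u (α β : ℝ) : ⟪u α, u β⟫ = Real.cos (β - α) := by
  simp [u, PiLp.inner_apply, Fin.sum_univ_two, Real.cos_sub]

theorem sin_smul_u (α β θ : ℝ) :
    Real.sin (β - α) • u θ = Real.sin (θ - α) • u β + Real.sin (β - θ) • u α := by
  ext i
  fin_cases i
  · simp [u, Real.sin_sub]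
    ring
  · simp [u, Real.sin_sub]
    ring

/-- A unit vector whose angle lies in `[α, β]`, with `β - α < π`, is in the cone spanned by
the two extreme unit vectors. -/
theorem exists_nonneg_u_eq {α β θ : ℝ} (hα : α ≤ θ) (hβ : θ ≤ β) (hπ : β - α < Real.pi) :
    ∃ a b : ℝ, 0 ≤ a ∧ 0 ≤ b ∧ u θ = a • u β + b • u α := by
  rcases (hα.trans hβ).eq_or_lt with h | h
  · obtain rfl : θ = β := le_antisymm hβ (h ▸ hα)
    exact ⟨1, 0, zero_le_one, le_rfl, by simp⟩
  · have hs : 0 < Real.sin (β - α) := Real.sin_pos_of_pos_of_lt_pi (by linarith) hπ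
    refine ⟨Real.sin (θ - α) / Real.sin (β - α), Real.sin (β - θ) / Real.sin (β - α),
      div_nonneg (Real.sin_nonneg_of_nonneg_of_le_pi (by linarith) (by linarith)) hs.le,
      div_nonneg (Real.sin_nonneg_of_nonneg_of_le_pi (by linarith) (by linarith)) hs.le, ?_⟩
    rw [div_eq_inv_mul, div_eq_inv_mul, mul_smul, mul_smul, ← smul_add, ← sin_smul_u,
      inv_smul_smul₀ hs.ne']

/-- Lemma 2 of the paper: the translated circular sector (the set consistent with combined
relative range and bearing measurements) is outer bounded by the extended constrained
zonotope given by the cone coefficients together with a hyperplane-band constraint. -/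
theorem stmt7 (Rlo Rhi θlo θhi : ℝ) (h0 : 0 ≤ Rlo) (hR : Rlo ≤ Rhi) (hθ : θlo ≤ θhi)
    (hπ : θhi - θlo < Real.pi) (c : EuclideanSpace ℝ (Fin 2)) :
    {z : EuclideanSpace ℝ (Fin 2) |
        ∃ r θ : ℝ, Rlo ≤ r ∧ r ≤ Rhi ∧ θlo ≤ θ ∧ θ ≤ θhi ∧ z = c + r • u θ} ⊆
      {z : EuclideanSpace ℝ (Fin 2) |
        ∃ ξ₁ ξ₂ : ℝ,
          0 ≤ ξ₁ ∧ ξ₁ ≤ Rhi / Real.cos ((θhi - θlo) / 2) ∧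
          0 ≤ ξ₂ ∧ ξ₂ ≤ Rhi / Real.cos ((θhi - θlo) / 2) ∧
          Rlo * Real.cos ((θhi - θlo) / 2) ≤
            ⟪u ((θhi + θlo) / 2), ξ₁ • u θhi + ξ₂ • u θlo⟫ ∧
          ⟪u ((θhi + θlo) / 2), ξ₁ • u θhi + ξ₂ • u θlo⟫ ≤ Rhi ∧
          z = c + (ξ₁ • u θhi + ξ₂ • u θlo)} := by
  rintro z ⟨r, θ, hr1, hr2, hθ1, hθ2, rfl⟩
  obtain ⟨a, b, ha, hb, hab⟩ := exists_nonneg_u_eq hθ1 hθ2 hπ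
  have hr : 0 ≤ r := h0.trans hr1
  have hc : 0 < Real.cos ((θhi - θlo) / 2) :=
    Real.cos_pos_of_mem_Ioo ⟨by linarith, by linarith⟩
  have hsmul : r • u θ = (r * a) • u θhi + (r * b) • u θlo := by
    rw [hab, smul_add, mul_smul, mul_smul]
  have hinner : ⟪u ((θhi + θlo) / 2), (r * a) • u θhi + (r * b) • u θlo⟫ =
      r * Real.cos (θ - (θhi + θlo) / 2) := by
    rw [← hsmul, inner_smul_right, inner_u_u]
  have hcone : (r * a + r * b) * Real.cos ((θhi - θlo) / 2) =
      r * Real.cos (θ - (θhi + θlo) / 2) := by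
    rw [← hinner, inner_add_right, inner_smul_right, inner_smul_right, inner_u_u, inner_u_u,
      show θhi - (θhi + θlo) / 2 = (θhi - θlo) / 2 by ring,
      show θlo - (θhi + θlo) / 2 = -((θhi - θlo) / 2) by ring, Real.cos_neg]
    ring
  have hupper : r * Real.cos (θ - (θhi + θlo) / 2) ≤ Rhi :=
    (mul_le_of_le_one_right hr (Real.cos_le_one _)).trans hr2
  have hlower : Real.cos ((θhi - θlo) / 2) ≤ Real.cos (θ - (θhi + θlo) / 2) := by
    rw [← Real.cos_abs (θ - (θhi + θlo) / 2)]
    exact Real.cos_le_cos_of_nonneg_of_le_pi (abs_nonneg _) (by linarith [Real.pi_pos])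
      (abs_le.2 ⟨by linarith, by linarith⟩)
  have hra : 0 ≤ r * a := mul_nonneg hr ha
  have hrb : 0 ≤ r * b := mul_nonneg hr hb
  have hsum : r * a + r * b ≤ Rhi / Real.cos ((θhi - θlo) / 2) := by
    rw [le_div_iff₀ hc, hcone]
    exact hupper
  refine ⟨r * a, r * b, hra, by linarith, hrb, by linarith, ?_, ?_, by rw [hsmul]⟩
  · rw [hinner]
    exact mul_le_mul hr1 hlower hc.le hr
  · rw [hinner]
    exact hupper
end

section
/- Let 0 < R̲ ≤ R̄, let K ⊆ ℝ² be a convex set such that ‖k‖ ≥ R̲ for every k ∈ K, and suppose E = r_E·u(θ_E) ∈ K and F = r_F·u(θ_F) ∈ K with R̲ ≤ r_E ≤ R̄, R̲ ≤ r_F ≤ R̄, and 0 ≤ θ_F − θ_E < π. Then for every θ ∈ [θ_E, θ_F] there exists a point z ∈ K with z = ρ·u(θ) for some ρ ∈ [R̲, R̄]. (Proposition 3 of the paper: if two angular sectors of the ring both intersect the convex prior set, then every intermediate angular sector also intersects it.) -/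
theorem norm_u (θ : ℝ) : ‖u θ‖ = 1 := by
  simp [u, EuclideanSpace.norm_eq]

/-- A direction strictly between two others is a combination of them with sine weights. -/
theorem sin_smul_u_sub_add_sin_smul_u_add (θ a b : ℝ) :
    Real.sin b • u (θ - a) + Real.sin a • u (θ + b) = Real.sin (a + b) • u θ := by
  ext i
  fin_cases i
  · simp [u, Real.cos_sub, Real.cos_add, Real.sin_add]
    ring
  · simp [u, Real.sin_sub, Real.sin_add]
    ring

/-- Proposition 3 of the paper: if two angular sectors of the ring
`{s : R̲ ≤ ‖s‖ ≤ R̄}` both intersect the convex prior set `K` (at `E = r_E·u(θ_E)` and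
`F = r_F·u(θ_F)`), then every intermediate angular direction also meets `K` inside the
ring. -/
theorem stmt11 (Rlo Rhi : ℝ) (h0 : 0 < Rlo) (hR : Rlo ≤ Rhi)
    (K : Set (EuclideanSpace ℝ (Fin 2))) (hK : Convex ℝ K) (hKlo : ∀ k ∈ K, Rlo ≤ ‖k‖)
    (rE rF θE θF : ℝ) (hE : rE • u θE ∈ K) (hF : rF • u θF ∈ K)
    (hrE1 : Rlo ≤ rE) (hrE2 : rE ≤ Rhi) (hrF1 : Rlo ≤ rF) (hrF2 : rF ≤ Rhi)
    (h1 : 0 ≤ θF - θE) (h2 : θF - θE < Real.pi) :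
    ∀ θ ∈ Set.Icc θE θF, ∃ ρ ∈ Set.Icc Rlo Rhi, ρ • u θ ∈ K := by
  rintro θ ⟨hθE, hθF⟩
  rcases hθE.eq_or_lt with rfl | ha
  · exact ⟨rE, ⟨hrE1, hrE2⟩, hE⟩
  rcases hθF.eq_or_lt with rfl | hb
  · exact ⟨rF, ⟨hrF1, hrF2⟩, hF⟩
  obtain ⟨a, rfl⟩ : ∃ a, θE = θ - a := ⟨θ - θE, by ring⟩
  obtain ⟨b, rfl⟩ : ∃ b, θF = θ + b := ⟨θF - θ, by ring⟩
  have hsa : 0 < Real.sin a := Real.sin_pos_of_pos_of_lt_pi (by linarith) (by linarith)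
  have hsb : 0 < Real.sin b := Real.sin_pos_of_pos_of_lt_pi (by linarith) (by linarith)
  have hsab : 0 < Real.sin (a + b) :=
    Real.sin_pos_of_pos_of_lt_pi (by linarith) (by linarith)
  have hE0 : 0 < rE := h0.trans_le hrE1
  have hF0 : 0 < rF := h0.trans_le hrF1
  set D := rE * Real.sin a + rF * Real.sin b with hD
  have hD0 : 0 < D := by positivity
  have hmem : (rE * rF * Real.sin (a + b) / D) • u θ ∈ K := by
    have h := hK hE hF (a := rF * Real.sin b / D) (b := rE * Real.sin a / D)
      (by positivity) (by positivity) (by rw [← add_div, add_comm, ← hD, div_self hD0.ne'])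
    convert h using 1
    rw [mul_div_right_comm, mul_smul, ← sin_smul_u_sub_add_sin_smul_u_add]
    module
  refine ⟨_, ⟨?_, ?_⟩, hmem⟩
  · have h := hKlo _ hmem
    rwa [norm_smul, norm_u, mul_one, Real.norm_of_nonneg (by positivity)] at h
  · rw [div_le_iff₀ hD0]
    have hsub : Real.sin (a + b) ≤ Real.sin a + Real.sin b := by
      rw [Real.sin_add]
      nlinarith [Real.cos_le_one a, Real.cos_le_one b]
    calc rE * rF * Real.sin (a + b)
        ≤ rE * rF * (Real.sin a + Real.sin b) := by gcongr
      _ = rF * (rE * Real.sin a) + rE * (rF * Real.sin b) := by ring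
      _ ≤ Rhi * (rE * Real.sin a) + Rhi * (rF * Real.sin b) := by gcongr
      _ = Rhi * D := by rw [hD]; ring
end

section
/- Let V be a real inner product space, let r > 0, let K ⊆ V be a set with diameter d(K) < r such that ‖k‖ ≥ r for every k ∈ K. Then for all E, F ∈ K, the angle between E and F is strictly less than π/3. (Second claim of Proposition 3: with q₁ and q₂ the extreme sector indices meeting the prior set among M equal angular sectors, the total angular span 2π(q₂ − q₁)/M subtended by the intersecting sectors is less than π/3.) -/
/-- Second claim of Proposition 3: if `K` has diameter strictly less than `r` and lies
outside the ball of radius `r`, then any two points of `K` subtend an angle strictly less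
than `π/3` at the origin. -/
theorem stmt12 {V : Type*} [NormedAddCommGroup V] [InnerProductSpace ℝ V]
    (r : ℝ) (hr : 0 < r) (K : Set V)
    (hdiam : EMetric.diam K < ENNReal.ofReal r) (hKlo : ∀ k ∈ K, r ≤ ‖k‖) :
    ∀ E ∈ K, ∀ F ∈ K, InnerProductGeometry.angle E F < Real.pi / 3 := by
  intro E hE F hF
  have hdist : ‖E - F‖ < r := by
    have h := (Metric.edist_le_ediam_of_mem hE hF).trans_lt hdiam
    rwa [edist_dist, ENNReal.ofReal_lt_ofReal_iff hr, dist_eq_norm] at h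
  by_contra! hangle
  have hcos : Real.cos (InnerProductGeometry.angle E F) ≤ 1 / 2 := by
    rw [← Real.cos_pi_div_three]
    exact Real.cos_le_cos_of_nonneg_of_le_pi (by positivity)
      (InnerProductGeometry.angle_le_pi E F) hangle
  have hinner : inner ℝ E F ≤ ‖E‖ * ‖F‖ / 2 := by
    rw [← InnerProductGeometry.cos_angle_mul_norm_mul_norm]
    nlinarith [mul_nonneg (norm_nonneg E) (norm_nonneg F)]
  have hsq := norm_sub_sq_real E F
  have hE' := hKlo E hE
  have hF' := hKlo F hF
  nlinarith [norm_nonneg (E - F), sq_nonneg (‖E‖ - ‖F‖),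
    mul_nonneg (sub_nonneg.2 hE') (sub_nonneg.2 hF')]
end
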